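/- For every α ∈ (0, π/2], one has (sin(α)/α)⁴ ≤ 1 − (2/3)·sin²(α). -/

import Mathlib

open Real

theorem nonneg_of_hasDerivAt_nonneg {f f' : ℝ → ℝ} (hf : ∀ x, HasDerivAt f (f' x) x)
    (h0 : f 0 = 0) (hf' : ∀ x, 0 ≤ x → 0 ≤ f' x) {x : ℝ} (hx : 0 ≤ x) : 0 ≤ f x := by
  have hmono : MonotoneOn f (Set.Ici 0) := by
    refine monotoneOn_of_deriv_nonneg (convex_Ici 0)
      (fun y _ => (hf y).continuousAt.continuousWithinAt)
      (fun y _ => (hf y).differentiableAt.differentiableWithinAt) fun y hy => ?_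
    rw [(hf y).deriv]
    exact hf' y (interior_subset hy)
  exact h0 ▸ hmono Set.self_mem_Ici hx hx

theorem cos_le_taylor_four {x : ℝ} (hx : 0 ≤ x) :
    cos x ≤ 1 - x ^ 2 / 2 + x ^ 4 / 24 := by
  have h : 0 ≤ 1 - x ^ 2 / 2 + x ^ 4 / 24 - cos x := by
    refine nonneg_of_hasDerivAt_nonneg (f := fun x => 1 - x ^ 2 / 2 + x ^ 4 / 24 - cos x)
      (f' := fun x => sin x - (x - x ^ 3 / 6)) (fun y => ?_) (by simp)
      (fun y hy => sub_nonneg.2 (sin_ge_sub_cube hy)) hx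
    convert! (((hasDerivAt_pow 2 y).div_const 2).const_sub 1).add
      ((hasDerivAt_pow 4 y).div_const 24) |>.sub (hasDerivAt_cos y) using 1
    norm_num
    ring
  linarith

theorem sin_le_taylor_five {x : ℝ} (hx : 0 ≤ x) :
    sin x ≤ x - x ^ 3 / 6 + x ^ 5 / 120 := by
  have h : 0 ≤ x - x ^ 3 / 6 + x ^ 5 / 120 - sin x := by
    refine nonneg_of_hasDerivAt_nonneg (f := fun x => x - x ^ 3 / 6 + x ^ 5 / 120 - sin x)
      (f' := fun x => 1 - x ^ 2 / 2 + x ^ 4 / 24 - cos x) (fun y => ?_) (by simp)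
      (fun y hy => sub_nonneg.2 (cos_le_taylor_four hy)) hx
    convert! ((hasDerivAt_id y).sub ((hasDerivAt_pow 3 y).div_const 6)).add
      ((hasDerivAt_pow 5 y).div_const 120) |>.sub (hasDerivAt_sin y) using 1
    norm_num
    ring
  linarith

theorem taylor_six_le_cos {x : ℝ} (hx : 0 ≤ x) :
    1 - x ^ 2 / 2 + x ^ 4 / 24 - x ^ 6 / 720 ≤ cos x := by
  have h : 0 ≤ cos x - (1 - x ^ 2 / 2 + x ^ 4 / 24 - x ^ 6 / 720) := by
    refine nonneg_of_hasDerivAt_nonneg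
      (f := fun x => cos x - (1 - x ^ 2 / 2 + x ^ 4 / 24 - x ^ 6 / 720))
      (f' := fun x => x - x ^ 3 / 6 + x ^ 5 / 120 - sin x) (fun y => ?_) (by simp)
      (fun y hy => sub_nonneg.2 (sin_le_taylor_five hy)) hx
    convert! (hasDerivAt_cos y).sub ((((hasDerivAt_pow 2 y).div_const 2).const_sub 1).add
      ((hasDerivAt_pow 4 y).div_const 24) |>.sub ((hasDerivAt_pow 6 y).div_const 720)) using 1
    norm_num
    ring
  linarith

theorem sin_sq_le_taylor_six {x : ℝ} (hx : 0 ≤ x) :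
    sin x ^ 2 ≤ x ^ 2 * (1 - x ^ 2 / 3 + 2 * x ^ 4 / 45) := by
  have h := taylor_six_le_cos (x := 2 * x) (by positivity)
  rw [sin_sq_eq_half_sub]
  ring_nf at h ⊢
  linarith

/-- For every `α ∈ (0, π/2]`, `(sin α / α)⁴ ≤ 1 − (2/3) sin² α`. -/
theorem sin_div_self_pow_four_le (α : ℝ) (hα : α ∈ Set.Ioc 0 (π / 2)) :
    (Real.sin α / α) ^ 4 ≤ 1 - 2 / 3 * (Real.sin α) ^ 2 := by
  obtain ⟨hpos, hle⟩ := hα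
  have hsq : α ^ 2 ≤ 3 := by nlinarith [pi_lt_d2]
  have hratio : (sin α / α) ^ 2 ≤ 1 - α ^ 2 / 3 + 2 * α ^ 4 / 45 := by
    rw [div_pow, div_le_iff₀' (by positivity)]
    exact sin_sq_le_taylor_six hpos.le
  have hsin : sin α ^ 2 = α ^ 2 * (sin α / α) ^ 2 := by field_simp
  set r := 1 - α ^ 2 / 3 + 2 * α ^ 4 / 45 with hr
  have hbound : r ^ 2 + 2 / 3 * (α ^ 2 * r) ≤ 1 := by
    have hfac : 1 - (r ^ 2 + 2 / 3 * (α ^ 2 * r)) = α ^ 4 / 45 * (1 - 4 / 45 * (α ^ 2) ^ 2) := by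
      rw [hr]; ring
    have : 0 ≤ 1 - 4 / 45 * (α ^ 2) ^ 2 := by nlinarith [sq_nonneg α]
    have : 0 ≤ α ^ 4 / 45 * (1 - 4 / 45 * (α ^ 2) ^ 2) := by positivity
    linarith
  have hfour : (sin α / α) ^ 4 ≤ r ^ 2 := by
    calc (sin α / α) ^ 4 = ((sin α / α) ^ 2) ^ 2 := by ring
      _ ≤ r ^ 2 := by gcongr
  have htwo : sin α ^ 2 ≤ α ^ 2 * r := by rw [hsin]; gcongr
  linarith
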